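/- arXiv:2006.02614 — 4 statements merged into one kernel-verified Lean document; each statement's English description precedes it below -/
import Mathlib

section
/- Let M and F be D×D real matrices with M symmetric and F antisymmetric, and let Ω be the bilinear form on ℝ^D × ℝ^D defined by Ω((Xq,Xv),(Yq,Yv)) = Σ_{a,b} F_{ab} Xq^a Yq^b + Σ_{a,b} M_{ab}(Xq^a Yv^b − Yq^a Xv^b). Then dim(ker Ω) = N₀ + D̄, where N₀ = dim(ker M) and D̄ = dim{C ∈ ker M : ⟨z, F·C⟩ = 0 for all z ∈ ker M}. In particular dim(ker Ω) ≤ 2N₀. -/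
open Matrix

/-- The presymplectic Lagrangian two-form
`Ω((Xq,Xv),(Yq,Yv)) = Σ F_{ab} Xq^a Yq^b + Σ M_{ab}(Xq^a Yv^b − Yq^a Xv^b)`
on `ℝ^D × ℝ^D`. -/
def Omega (D : ℕ) (M F : Matrix (Fin D) (Fin D) ℝ)
    (X Y : (Fin D → ℝ) × (Fin D → ℝ)) : ℝ :=
  X.1 ⬝ᵥ F.mulVec Y.1 + X.1 ⬝ᵥ M.mulVec Y.2 - Y.1 ⬝ᵥ M.mulVec X.2

/-- The kernel of `Omega` as a submodule of `ℝ^D × ℝ^D`. -/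
def kerOmega (D : ℕ) (M F : Matrix (Fin D) (Fin D) ℝ) :
    Submodule ℝ ((Fin D → ℝ) × (Fin D → ℝ)) where
  carrier := {K | ∀ Y, Omega D M F K Y = 0}
  add_mem' := by
    intro a b ha hb Y
    have h1 := ha Y
    have h2 := hb Y
    simp only [Omega] at h1 h2 ⊢
    simp only [Prod.fst_add, Prod.snd_add, add_dotProduct, Matrix.mulVec_add, dotProduct_add]
    linarith
  zero_mem' := by
    intro Y
    simp [Omega]
  smul_mem' := by
    intro c a ha Y
    have h := ha Y
    simp only [Omega] at h ⊢
    simp only [Prod.smul_fst, Prod.smul_snd, smul_dotProduct, Matrix.mulVec_smul,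
      dotProduct_smul, smul_eq_mul]
    linear_combination c * h

/-- The subspace `C̄ = {C ∈ ker M | ⟨z, F·C⟩ = 0 for all z ∈ ker M}`. -/
def barC (D : ℕ) (M F : Matrix (Fin D) (Fin D) ℝ) : Submodule ℝ (Fin D → ℝ) where
  carrier := {C | M.mulVec C = 0 ∧ ∀ z, M.mulVec z = 0 → z ⬝ᵥ F.mulVec C = 0}
  add_mem' := by
    intro a b ha hb
    refine ⟨by simp [Matrix.mulVec_add, ha.1, hb.1], ?_⟩
    intro z hz
    have h1 := ha.2 z hz
    have h2 := hb.2 z hz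
    simp only [Matrix.mulVec_add, dotProduct_add]
    linarith
  zero_mem' := by
    refine ⟨by simp, ?_⟩
    intro z hz
    simp
  smul_mem' := by
    intro c a ha
    refine ⟨by simp [Matrix.mulVec_smul, ha.1], ?_⟩
    intro z hz
    have h := ha.2 z hz
    simp [Matrix.mulVec_smul, dotProduct_smul, smul_eq_mul, h]

/-- A vector orthogonal to the kernel of `Mᵀ` lies in the range of `M`. -/
theorem exists_mulVec_eq_of_forall_dotProduct_eq_zero {K m n : Type*} [Field K] [Fintype m]
    [DecidableEq m] [Fintype n] (M : Matrix m n K) (w : m → K)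
    (hw : ∀ z, Mᵀ *ᵥ z = 0 → z ⬝ᵥ w = 0) : ∃ x, M *ᵥ x = w := by
  by_contra hne
  obtain ⟨f, hfw, hf⟩ := Submodule.exists_le_ker_of_notMem
    (p := LinearMap.range M.mulVecLin) (v := w) (fun ⟨x, hx⟩ => hne ⟨x, hx⟩)
  obtain ⟨z, rfl⟩ := (dotProductEquiv K m).surjective f
  refine hfw (hw z (dotProduct_eq_zero _ fun x => ?_))
  rw [mulVec_transpose, ← dotProduct_mulVec]
  exact hf ⟨x, rfl⟩

theorem mem_kerOmega_iff {D : ℕ} {M F : Matrix (Fin D) (Fin D) ℝ} (hM : M.IsSymm)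
    (hF : Fᵀ = -F) {K : (Fin D → ℝ) × (Fin D → ℝ)} :
    K ∈ kerOmega D M F ↔ M *ᵥ K.1 = 0 ∧ M *ᵥ K.2 = -(F *ᵥ K.1) := by
  have key (Y : (Fin D → ℝ) × (Fin D → ℝ)) :
      Omega D M F K Y = (-(F *ᵥ K.1) - M *ᵥ K.2) ⬝ᵥ Y.1 + (M *ᵥ K.1) ⬝ᵥ Y.2 := by
    rw [Omega, dotProduct_mulVec, dotProduct_mulVec, ← mulVec_transpose, ← mulVec_transpose,
      hM.eq, hF, neg_mulVec, dotProduct_comm Y.1, sub_dotProduct]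
    ring
  constructor
  · intro h
    have h1 : -(F *ᵥ K.1) - M *ᵥ K.2 = 0 :=
      dotProduct_eq_zero _ fun y => by simpa using (key (y, 0)).symm.trans (h (y, 0))
    have h2 : M *ᵥ K.1 = 0 :=
      dotProduct_eq_zero _ fun y => by simpa using (key (0, y)).symm.trans (h (0, y))
    exact ⟨h2, (sub_eq_zero.mp h1).symm⟩
  · rintro ⟨h1, h2⟩ Y
    rw [key, h1, h2]
    simp

/-- The horizontal projection of `ker Ω`. -/
theorem map_fst_kerOmega {D : ℕ} {M F : Matrix (Fin D) (Fin D) ℝ} (hM : M.IsSymm)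
    (hF : Fᵀ = -F) :
    (kerOmega D M F).map (LinearMap.fst ℝ (Fin D → ℝ) (Fin D → ℝ)) = barC D M F := by
  ext C
  constructor
  · rintro ⟨K, hK, rfl⟩
    obtain ⟨h1, h2⟩ := (mem_kerOmega_iff hM hF).mp hK
    refine ⟨h1, fun z hz => ?_⟩
    rw [LinearMap.fst_apply, ← neg_eq_iff_eq_neg.mpr h2, dotProduct_neg, dotProduct_mulVec,
      ← mulVec_transpose, hM.eq, hz]
    simp
  · rintro ⟨h1, h2⟩
    obtain ⟨v, hv⟩ := exists_mulVec_eq_of_forall_dotProduct_eq_zero M (-(F *ᵥ C))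
      fun z hz => by rw [dotProduct_neg, h2 z (by rwa [hM.eq] at hz), neg_zero]
    exact ⟨(C, v), (mem_kerOmega_iff hM hF).mpr ⟨h1, hv⟩, rfl⟩

/-- The vertical vectors in `ker Ω`. -/
theorem map_inr_ker_mulVecLin {D : ℕ} {M F : Matrix (Fin D) (Fin D) ℝ} (hM : M.IsSymm)
    (hF : Fᵀ = -F) :
    (LinearMap.ker M.mulVecLin).map (LinearMap.inr ℝ (Fin D → ℝ) (Fin D → ℝ)) =
      (LinearMap.ker ((LinearMap.fst ℝ (Fin D → ℝ) (Fin D → ℝ)).domRestrict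
        (kerOmega D M F))).map (kerOmega D M F).subtype := by
  ext ⟨q, v⟩
  constructor
  · rintro ⟨z, hz, h⟩
    rw [← h]
    exact ⟨⟨(0, z), (mem_kerOmega_iff hM hF).mpr ⟨by simp, by simpa using hz⟩⟩, rfl, rfl⟩
  · rintro ⟨⟨K, hK⟩, h0, h⟩
    obtain rfl : K = (q, v) := h
    obtain rfl : q = 0 := h0
    exact ⟨v, by simpa using ((mem_kerOmega_iff hM hF).mp hK).2, rfl⟩

/-- **Theorem (dimension of `ker Ω`).**
`dim(ker Ω) = N₀ + D̄` where `N₀ = dim(ker M)` and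
`D̄ = dim{C ∈ ker M | ⟨z, F·C⟩ = 0 for all z ∈ ker M}`; in particular
`dim(ker Ω) ≤ 2·N₀`. -/
theorem finrank_ker_Omega (D : ℕ) (M F : Matrix (Fin D) (Fin D) ℝ)
    (hM : M.IsSymm) (hF : Fᵀ = -F) :
    Module.finrank ℝ (kerOmega D M F) =
        Module.finrank ℝ (LinearMap.ker M.mulVecLin) + Module.finrank ℝ (barC D M F) ∧
      Module.finrank ℝ (kerOmega D M F) ≤
        2 * Module.finrank ℝ (LinearMap.ker M.mulVecLin) := by
  have hrange := LinearMap.finrank_range_add_finrank_ker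
    ((LinearMap.fst ℝ (Fin D → ℝ) (Fin D → ℝ)).domRestrict (kerOmega D M F))
  have hker := ((Submodule.equivMapOfInjective _ LinearMap.inr_injective _).trans
    ((LinearEquiv.ofEq _ _ (map_inr_ker_mulVecLin hM hF)).trans
      (Submodule.equivMapOfInjective _ (kerOmega D M F).subtype_injective _).symm)).finrank_eq
  rw [LinearMap.range_domRestrict, map_fst_kerOmega hM hF] at hrange
  have hle : Module.finrank ℝ (barC D M F) ≤ Module.finrank ℝ (LinearMap.ker M.mulVecLin) :=
    Submodule.finrank_mono fun C hC => hC.1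
  omega
end

section
/- Let L : ℝ^D × ℝ^D → ℝ be twice continuously differentiable, let M(q,v) be its velocity Hessian M_{ab} = ∂²L/∂v^a∂v^b, F(q,v) the antisymmetric matrix F_{ab} = ∂²L/∂v^a∂q^b − ∂²L/∂v^b∂q^a, and let Ω_L(q,v) be the bilinear form on ℝ^D × ℝ^D given by Ω_L((Xq,Xv),(Yq,Yv)) = Σ F_{ab} Xq^a Yq^b + Σ M_{ab}(Xq^a Yv^b − Yq^a Xv^b). Let FL(q,v) = (q, ∂L/∂v(q,v)) be the fibre derivative and T its Fréchet derivative at (q,v). Then for all X, Y ∈ ℝ^D × ℝ^D, Ω_L(q,v)(X,Y) = ω(T X, T Y), where ω((a,b),(c,d)) = ⟨a,d⟩ − ⟨c,b⟩ is the canonical symplectic bilinear form on ℝ^D × ℝ^D. (That is, the pullback of the canonical symplectic form under the fibre derivative is the Lagrangian two-form.) -/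
open Matrix

/-- Gradient of `L` in the velocity variables: `(∇_v L)_a = ∂L/∂v^a`. -/
noncomputable def gradV (D : ℕ) (L : (Fin D → ℝ) × (Fin D → ℝ) → ℝ)
    (u : (Fin D → ℝ) × (Fin D → ℝ)) : Fin D → ℝ :=
  fun a => fderiv ℝ L u (0, Pi.single a 1)

/-- Gradient of a phase-space function in the position variables. -/
noncomputable def gradQ (D : ℕ) (f : (Fin D → ℝ) × (Fin D → ℝ) → ℝ)
    (u : (Fin D → ℝ) × (Fin D → ℝ)) : Fin D → ℝ :=
  fun a => fderiv ℝ f u (Pi.single a 1, 0)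

/-- The fibre derivative (Legendre map) `FL(q,v) = (q, ∂L/∂v(q,v))`. -/
noncomputable def FL (D : ℕ) (L : (Fin D → ℝ) × (Fin D → ℝ) → ℝ) :
    (Fin D → ℝ) × (Fin D → ℝ) → (Fin D → ℝ) × (Fin D → ℝ) :=
  fun u => (u.1, gradV D L u)

/-- The velocity Hessian `M_{ab} = ∂²L/∂v^a∂v^b`. -/
noncomputable def hessV (D : ℕ) (L : (Fin D → ℝ) × (Fin D → ℝ) → ℝ)
    (u : (Fin D → ℝ) × (Fin D → ℝ)) : Matrix (Fin D) (Fin D) ℝ :=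
  Matrix.of fun a b =>
    fderiv ℝ (fun w => fderiv ℝ L w (0, Pi.single a 1)) u (0, Pi.single b 1)

/-- The antisymmetric matrix `F_{ab} = ∂²L/∂v^a∂q^b − ∂²L/∂v^b∂q^a`. -/
noncomputable def Fmat (D : ℕ) (L : (Fin D → ℝ) × (Fin D → ℝ) → ℝ)
    (u : (Fin D → ℝ) × (Fin D → ℝ)) : Matrix (Fin D) (Fin D) ℝ :=
  Matrix.of fun a b =>
    fderiv ℝ (fun w => fderiv ℝ L w (0, Pi.single a 1)) u (Pi.single b 1, 0)
      - fderiv ℝ (fun w => fderiv ℝ L w (0, Pi.single b 1)) u (Pi.single a 1, 0)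

/-- The energy `E(q,v) = ⟨v, ∂L/∂v⟩ − L(q,v)`. -/
noncomputable def energy (D : ℕ) (L : (Fin D → ℝ) × (Fin D → ℝ) → ℝ)
    (u : (Fin D → ℝ) × (Fin D → ℝ)) : ℝ :=
  u.2 ⬝ᵥ gradV D L u - L u

/-- The canonical symplectic bilinear pairing `ω((a,b),(c,d)) = ⟨a,d⟩ − ⟨c,b⟩`. -/
def omegaCan (D : ℕ) (X Y : (Fin D → ℝ) × (Fin D → ℝ)) : ℝ :=
  X.1 ⬝ᵥ Y.2 - Y.1 ⬝ᵥ X.2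

/-- The mixed Hessian `A_{ab} = ∂²L/∂v^a∂q^b`. -/
noncomputable def hessVQ (D : ℕ) (L : (Fin D → ℝ) × (Fin D → ℝ) → ℝ)
    (u : (Fin D → ℝ) × (Fin D → ℝ)) : Matrix (Fin D) (Fin D) ℝ :=
  Matrix.of fun a b =>
    fderiv ℝ (fun w => fderiv ℝ L w (0, Pi.single a 1)) u (Pi.single b 1, 0)

theorem Fmat_eq_hessVQ_sub_transpose (D : ℕ) (L : (Fin D → ℝ) × (Fin D → ℝ) → ℝ)
    (u : (Fin D → ℝ) × (Fin D → ℝ)) :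
    Fmat D L u = hessVQ D L u - (hessVQ D L u)ᵀ :=
  rfl

/-- A linear functional on `ℝ^D × ℝ^D` in terms of its values on the standard basis. -/
theorem clm_prod_pi_apply {D : ℕ} (f : (Fin D → ℝ) × (Fin D → ℝ) →L[ℝ] ℝ)
    (X : (Fin D → ℝ) × (Fin D → ℝ)) :
    f X = (fun b => f (Pi.single b 1, 0)) ⬝ᵥ X.1 + (fun b => f (0, Pi.single b 1)) ⬝ᵥ X.2 := by
  have h₁ := LinearMap.pi_apply_eq_sum_univ (f.toLinearMap ∘ₗ LinearMap.inl ℝ _ _) X.1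
  have h₂ := LinearMap.pi_apply_eq_sum_univ (f.toLinearMap ∘ₗ LinearMap.inr ℝ _ _) X.2
  have hX : X = (X.1, 0) + (0, X.2) := by simp
  have hs (b : Fin D) : (fun j => if b = j then (1 : ℝ) else 0) = Pi.single b 1 := by
    ext j
    simp [Pi.single_apply, eq_comm]
  simp only [hs, LinearMap.comp_apply, LinearMap.inl_apply, LinearMap.inr_apply,
    ContinuousLinearMap.coe_coe, smul_eq_mul] at h₁ h₂
  conv_lhs => rw [hX, map_add, h₁, h₂]
  simp only [dotProduct, mul_comm]

theorem fderiv_FL_apply {D : ℕ} {L : (Fin D → ℝ) × (Fin D → ℝ) → ℝ} (hL : ContDiff ℝ 2 L)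
    (u X : (Fin D → ℝ) × (Fin D → ℝ)) :
    fderiv ℝ (FL D L) u X = (X.1, hessVQ D L u *ᵥ X.1 + hessV D L u *ᵥ X.2) := by
  have hd : Differentiable ℝ (fderiv ℝ L) :=
    (hL.fderiv_right (m := 1) (by norm_num)).differentiable (by norm_num)
  have hg (a : Fin D) : DifferentiableAt ℝ (fun w => fderiv ℝ L w (0, Pi.single a 1)) u :=
    (hd u).clm_apply (differentiableAt_const _)
  have hF : HasFDerivAt (FL D L) _ u :=
    hasFDerivAt_fst.prodMk (hasFDerivAt_pi.2 fun a => (hg a).hasFDerivAt)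
  rw [hF.fderiv]
  refine Prod.ext rfl (funext fun a => ?_)
  exact clm_prod_pi_apply (fderiv ℝ (fun w => fderiv ℝ L w (0, Pi.single a 1)) u) X

/-- **Theorem (the Lagrangian two-form is the pullback of the canonical symplectic
form under the fibre derivative).**  For a C² Lagrangian `L` and any point `(q,v)`,
`Ω_L(q,v)(X,Y) = ω(T X, T Y)` for all `X, Y`, where `T` is the Fréchet derivative of
the fibre derivative `FL` at `(q,v)` and `ω` the canonical symplectic pairing. -/
theorem OmegaL_eq_pullback_canonical (D : ℕ)
    (L : (Fin D → ℝ) × (Fin D → ℝ) → ℝ) (hL : ContDiff ℝ 2 L)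
    (u : (Fin D → ℝ) × (Fin D → ℝ)) :
    ∀ X Y : (Fin D → ℝ) × (Fin D → ℝ),
      Omega D (hessV D L u) (Fmat D L u) X Y =
        omegaCan D (fderiv ℝ (FL D L) u X) (fderiv ℝ (FL D L) u Y) := by
  intro X Y
  have hT : X.1 ⬝ᵥ (hessVQ D L u)ᵀ *ᵥ Y.1 = Y.1 ⬝ᵥ hessVQ D L u *ᵥ X.1 := by
    rw [mulVec_transpose, dotProduct_comm, dotProduct_mulVec]
  simp only [Omega, omegaCan, fderiv_FL_apply hL, Fmat_eq_hessVQ_sub_transpose, sub_mulVec,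
    dotProduct_sub, dotProduct_add, hT]
  ring
end

section
/- Let L : ℝ^D × ℝ^D → ℝ be twice continuously differentiable, with velocity Hessian M(q,v), antisymmetric matrix F(q,v), energy E(q,v) = ⟨v, ∂L/∂v⟩ − L, and Lagrangian two-form Ω_L(q,v) as defined. Then X = (Xq,Xv) satisfies the energy equation at (q,v), i.e. Ω_L(q,v)(X,Y) = dE(q,v)(Y) for all Y ∈ ℝ^D × ℝ^D, if and only if M(q,v)·Xq = M(q,v)·v and M(q,v)·Xv = −(∇_q E(q,v) + F(q,v)·Xq). In particular, the horizontal component of any solution differs from v by an element of ker M(q,v). -/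
open Matrix

theorem fderiv_fderiv_apply_const {E G : Type*} [NormedAddCommGroup E] [NormedSpace ℝ E]
    [NormedAddCommGroup G] [NormedSpace ℝ G] {f : E → G} (hf : ContDiff ℝ 2 f) (u x y : E) :
    fderiv ℝ (fun w => fderiv ℝ f w x) u y = fderiv ℝ (fderiv ℝ f) u y x := by
  have h : DifferentiableAt ℝ (fderiv ℝ f) u :=
    ((hf.fderiv_right (m := 1) le_rfl).differentiable one_ne_zero) u
  have := (h.hasFDerivAt.clm_apply (hasFDerivAt_const x u)).fderiv
  rw [this]
  simp

theorem hessV_transpose (D : ℕ) {L : (Fin D → ℝ) × (Fin D → ℝ) → ℝ} (hL : ContDiff ℝ 2 L)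
    (u : (Fin D → ℝ) × (Fin D → ℝ)) : (hessV D L u)ᵀ = hessV D L u := by
  ext a b
  simp only [hessV, transpose_apply, of_apply, fderiv_fderiv_apply_const hL]
  exact (hL.contDiffAt.isSymmSndFDerivAt (by simp)) _ _

theorem Fmat_transpose (D : ℕ) (L : (Fin D → ℝ) × (Fin D → ℝ) → ℝ)
    (u : (Fin D → ℝ) × (Fin D → ℝ)) : (Fmat D L u)ᵀ = -Fmat D L u := by
  ext a b
  simp [Fmat]

/-- A linear functional on phase space is determined by its position and velocity gradients. -/
theorem clm_apply_eq_dotProduct_add (D : ℕ) (f : ((Fin D → ℝ) × (Fin D → ℝ)) →L[ℝ] ℝ)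
    (Y : (Fin D → ℝ) × (Fin D → ℝ)) :
    f Y = Y.1 ⬝ᵥ (fun a => f (Pi.single a 1, 0)) + Y.2 ⬝ᵥ (fun a => f (0, Pi.single a 1)) := by
  have h1 := LinearMap.pi_apply_eq_sum_univ
    ((f : _ →ₗ[ℝ] ℝ) ∘ₗ LinearMap.inl ℝ (Fin D → ℝ) (Fin D → ℝ)) Y.1
  have h2 := LinearMap.pi_apply_eq_sum_univ
    ((f : _ →ₗ[ℝ] ℝ) ∘ₗ LinearMap.inr ℝ (Fin D → ℝ) (Fin D → ℝ)) Y.2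
  have h : f Y = f (Y.1, 0) + f (0, Y.2) := by rw [← map_add]; simp
  have hs (i : Fin D) : (fun j => if i = j then (1 : ℝ) else 0) = Pi.single i 1 := by
    ext j; simp [Pi.single_apply, eq_comm]
  simp only [hs] at h1 h2
  simp at h1 h2
  rw [h, h1, h2]
  rfl

theorem gradV_energy (D : ℕ) {L : (Fin D → ℝ) × (Fin D → ℝ) → ℝ} (hL : ContDiff ℝ 2 L)
    (u : (Fin D → ℝ) × (Fin D → ℝ)) :
    gradV D (energy D L) u = (hessV D L u).mulVec u.2 := by
  have hd : DifferentiableAt ℝ (fderiv ℝ L) u :=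
    ((hL.fderiv_right (m := 1) le_rfl).differentiable one_ne_zero) u
  have hg (a : Fin D) : HasFDerivAt (fun w => fderiv ℝ L w (0, Pi.single a 1))
      (fderiv ℝ (fun w => fderiv ℝ L w (0, Pi.single a 1)) u) u :=
    (hd.clm_apply (differentiableAt_const _)).hasFDerivAt
  have hv (a : Fin D) : HasFDerivAt (fun w : (Fin D → ℝ) × (Fin D → ℝ) => w.2 a)
      ((ContinuousLinearMap.proj a : (Fin D → ℝ) →L[ℝ] ℝ).comp
        (ContinuousLinearMap.snd ℝ (Fin D → ℝ) (Fin D → ℝ))) u :=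
    ((ContinuousLinearMap.proj a : (Fin D → ℝ) →L[ℝ] ℝ).comp
      (ContinuousLinearMap.snd ℝ (Fin D → ℝ) (Fin D → ℝ))).hasFDerivAt
  have hE : HasFDerivAt (energy D L) _ u :=
    (HasFDerivAt.fun_sum fun a (_ : a ∈ Finset.univ) => (hv a).mul (hg a)).sub
      ((hL.differentiable two_ne_zero) u).hasFDerivAt
  ext b
  rw [← hessV_transpose D hL u]
  simp only [gradV, hE.fderiv]
  simp [Finset.sum_add_distrib, Pi.single_apply, mulVec, dotProduct, hessV, mul_comm]

theorem Omega_eq_dotProduct_add (D : ℕ) {M F : Matrix (Fin D) (Fin D) ℝ} (hM : Mᵀ = M)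
    (hF : Fᵀ = -F) (X Y : (Fin D → ℝ) × (Fin D → ℝ)) :
    Omega D M F X Y = Y.1 ⬝ᵥ (-(F.mulVec X.1) - M.mulVec X.2) + Y.2 ⬝ᵥ M.mulVec X.1 := by
  have h (A : Matrix (Fin D) (Fin D) ℝ) (x y : Fin D → ℝ) :
      x ⬝ᵥ A.mulVec y = y ⬝ᵥ Aᵀ.mulVec x := by
    rw [dotProduct_mulVec, dotProduct_comm, mulVec_transpose]
  rw [Omega, h F, h M X.1, hM, hF, neg_mulVec, dotProduct_sub]
  ring

/-- **Theorem (solutions of the energy equation).**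
`X = (Xq,Xv)` satisfies the energy equation `Ω_L(q,v)(X,·) = dE(q,v)` iff
`M·Xq = M·v` and `M·Xv = −(∇_q E + F·Xq)`.  In particular, the horizontal component
of any solution differs from `v` by an element of `ker M(q,v)`. -/
theorem energy_equation_iff (D : ℕ)
    (L : (Fin D → ℝ) × (Fin D → ℝ) → ℝ) (hL : ContDiff ℝ 2 L)
    (u : (Fin D → ℝ) × (Fin D → ℝ)) (X : (Fin D → ℝ) × (Fin D → ℝ)) :
    ((∀ Y, Omega D (hessV D L u) (Fmat D L u) X Y = fderiv ℝ (energy D L) u Y) ↔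
      ((hessV D L u).mulVec X.1 = (hessV D L u).mulVec u.2 ∧
        (hessV D L u).mulVec X.2 =
          -(gradQ D (energy D L) u + (Fmat D L u).mulVec X.1))) ∧
    ((∀ Y, Omega D (hessV D L u) (Fmat D L u) X Y = fderiv ℝ (energy D L) u Y) →
      (hessV D L u).mulVec (X.1 - u.2) = 0) := by
  have key : (∀ Y, Omega D (hessV D L u) (Fmat D L u) X Y = fderiv ℝ (energy D L) u Y) ↔
      ((hessV D L u).mulVec X.1 = (hessV D L u).mulVec u.2 ∧
        (hessV D L u).mulVec X.2 =
          -(gradQ D (energy D L) u + (Fmat D L u).mulVec X.1)) := by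
    have hE (Y : (Fin D → ℝ) × (Fin D → ℝ)) : fderiv ℝ (energy D L) u Y =
        Y.1 ⬝ᵥ gradQ D (energy D L) u + Y.2 ⬝ᵥ (hessV D L u).mulVec u.2 := by
      rw [← gradV_energy D hL]
      exact clm_apply_eq_dotProduct_add D _ Y
    simp only [Omega_eq_dotProduct_add D (hessV_transpose D hL u) (Fmat_transpose D L u), hE]
    constructor
    · intro h
      constructor
      · exact dotProduct_eq _ _ fun w => by simpa [dotProduct_comm] using h (0, w)
      · have hq : -((Fmat D L u).mulVec X.1) - (hessV D L u).mulVec X.2 =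
            gradQ D (energy D L) u :=
          dotProduct_eq _ _ fun w => by
            have := h (w, 0)
            simp only [zero_dotProduct, add_zero] at this
            rw [dotProduct_comm, this, dotProduct_comm]
        rw [← hq]
        abel
    · rintro ⟨h1, h2⟩ Y
      rw [h1, h2]
      congr 2
      abel
  exact ⟨key, fun h => by rw [mulVec_sub, (key.1 h).1, sub_self]⟩
end

section
/- Let L : ℝ^D × ℝ^D → ℝ be twice continuously differentiable, with velocity Hessian M(q,v), antisymmetric matrix F(q,v), energy E(q,v) = ⟨v, ∂L/∂v⟩ − L, and Lagrangian two-form Ω_L(q,v) as defined. If M(q,v) is invertible (the regular case), then the energy equation at (q,v) has exactly one solution X with Ω_L(q,v)(X,Y) = dE(q,v)(Y) for all Y, and this solution is second-order: its horizontal component equals v, and its vertical component equals −M(q,v)^{-1}(∇_q E(q,v) + F(q,v)·v). -/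
open Matrix

theorem dotProduct_Fmat_mulVec (D : ℕ) (L : (Fin D → ℝ) × (Fin D → ℝ) → ℝ)
    (u : (Fin D → ℝ) × (Fin D → ℝ)) (x y : Fin D → ℝ) :
    x ⬝ᵥ (Fmat D L u).mulVec y = -(y ⬝ᵥ (Fmat D L u).mulVec x) := by
  have hF : (Fmat D L u)ᵀ = -Fmat D L u := by
    ext a b
    simp [Fmat]
  rw [dotProduct_mulVec, ← mulVec_transpose, hF, neg_mulVec, neg_dotProduct, dotProduct_comm]

theorem LinearMap.apply_eq_dotProduct_single (D : ℕ) (B : (Fin D → ℝ) →ₗ[ℝ] ℝ)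
    (y : Fin D → ℝ) : B y = y ⬝ᵥ fun a => B (Pi.single a 1) := by
  conv_lhs => rw [pi_eq_sum_univ' y]
  rw [map_sum]
  refine Finset.sum_congr rfl fun a _ => ?_
  rw [map_smul, smul_eq_mul]

theorem map_inl_eq_dotProduct (D : ℕ) (A : (Fin D → ℝ) × (Fin D → ℝ) →L[ℝ] ℝ)
    (y : Fin D → ℝ) : A (y, 0) = y ⬝ᵥ fun a => A (Pi.single a 1, 0) :=
  LinearMap.apply_eq_dotProduct_single D
    ((A : (Fin D → ℝ) × (Fin D → ℝ) →ₗ[ℝ] ℝ) ∘ₗ LinearMap.inl ℝ _ _) y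

theorem map_inr_eq_dotProduct (D : ℕ) (A : (Fin D → ℝ) × (Fin D → ℝ) →L[ℝ] ℝ)
    (y : Fin D → ℝ) : A (0, y) = y ⬝ᵥ fun a => A (0, Pi.single a 1) :=
  LinearMap.apply_eq_dotProduct_single D
    ((A : (Fin D → ℝ) × (Fin D → ℝ) →ₗ[ℝ] ℝ) ∘ₗ LinearMap.inr ℝ _ _) y

theorem fderiv_energy_vertical (D : ℕ) (L : (Fin D → ℝ) × (Fin D → ℝ) → ℝ)
    (hL : ContDiff ℝ 2 L) (u : (Fin D → ℝ) × (Fin D → ℝ)) (y : Fin D → ℝ) :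
    fderiv ℝ (energy D L) u (0, y) = u.2 ⬝ᵥ (hessV D L u).mulVec y := by
  have hdL : Differentiable ℝ L := hL.differentiable (by norm_num)
  have hd2 : Differentiable ℝ (fderiv ℝ L) :=
    (hL.fderiv_right (m := 1) (by norm_num)).differentiable (by norm_num)
  have hg (a : Fin D) :
      DifferentiableAt ℝ (fun w => fderiv ℝ L w (0, Pi.single a 1)) u :=
    (hd2 u).clm_apply (differentiableAt_const _)
  have hv (a : Fin D) : HasFDerivAt (fun w : (Fin D → ℝ) × (Fin D → ℝ) => w.2 a)
      ((ContinuousLinearMap.proj a).comp (ContinuousLinearMap.snd ℝ _ _)) u :=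
    ((ContinuousLinearMap.proj (R := ℝ) (φ := fun _ : Fin D => ℝ) a).comp
      (ContinuousLinearMap.snd ℝ (Fin D → ℝ) (Fin D → ℝ))).hasFDerivAt
  have hE : HasFDerivAt (energy D L) _ u :=
    (HasFDerivAt.fun_sum (u := Finset.univ)
      fun a _ => (hv a).mul (hg a).hasFDerivAt).sub (hdL u).hasFDerivAt
  have hM (a : Fin D) : fderiv ℝ (fun w => fderiv ℝ L w (0, Pi.single a 1)) u (0, y) =
      (hessV D L u).mulVec y a := by
    rw [map_inr_eq_dotProduct, dotProduct_comm]
    rfl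
  rw [hE.fderiv]
  simp only [_root_.sub_apply, _root_.sum_apply, _root_.add_apply, _root_.smul_apply,
    ContinuousLinearMap.comp_apply, ContinuousLinearMap.coe_snd',
    ContinuousLinearMap.proj_apply, hM, smul_eq_mul, Finset.sum_add_distrib]
  rw [map_inr_eq_dotProduct D (fderiv ℝ L u)]
  simp only [dotProduct, mul_comm (y _)]
  ring

/-- **Theorem (regular case: unique second-order solution).**
If the velocity Hessian `M(q,v)` is invertible, the energy equation at `(q,v)` has
exactly one solution, namely the second-order vector field
`X = (v, −M⁻¹(∇_q E + F·v))`. -/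
theorem regular_unique_solution (D : ℕ)
    (L : (Fin D → ℝ) × (Fin D → ℝ) → ℝ) (hL : ContDiff ℝ 2 L)
    (u : (Fin D → ℝ) × (Fin D → ℝ)) (hM : IsUnit (hessV D L u)) :
    (∃! X : (Fin D → ℝ) × (Fin D → ℝ),
      ∀ Y, Omega D (hessV D L u) (Fmat D L u) X Y = fderiv ℝ (energy D L) u Y) ∧
    (∀ Y, Omega D (hessV D L u) (Fmat D L u)
        (u.2, -((hessV D L u)⁻¹.mulVec
          (gradQ D (energy D L) u + (Fmat D L u).mulVec u.2))) Y =
      fderiv ℝ (energy D L) u Y) := by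
  have hdet : IsUnit (hessV D L u).det := (isUnit_iff_isUnit_det _).1 hM
  have hsol : ∀ Y, Omega D (hessV D L u) (Fmat D L u)
        (u.2, -((hessV D L u)⁻¹.mulVec
          (gradQ D (energy D L) u + (Fmat D L u).mulVec u.2))) Y =
      fderiv ℝ (energy D L) u Y := by
    rintro ⟨y, w⟩
    have hY : ((y, w) : (Fin D → ℝ) × (Fin D → ℝ)) = (y, 0) + (0, w) := by simp
    have hq : fderiv ℝ (energy D L) u (y, 0) = y ⬝ᵥ gradQ D (energy D L) u :=
      map_inl_eq_dotProduct D _ y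
    rw [hY, map_add, fderiv_energy_vertical D L hL, hq, ← hY]
    simp only [Omega, mulVec_neg, mulVec_mulVec, mul_nonsing_inv _ hdet, one_mulVec,
      dotProduct_neg, dotProduct_add]
    rw [dotProduct_Fmat_mulVec]
    ring
  refine ⟨⟨_, hsol, fun X hX => ?_⟩, hsol⟩
  have hXS := fun Y => (hX Y).trans (hsol Y).symm
  generalize (u.2, -((hessV D L u)⁻¹.mulVec
    (gradQ D (energy D L) u + (Fmat D L u).mulVec u.2))) = S at hXS ⊢
  have h1 : X.1 = S.1 := by
    apply vecMul_injective_of_isUnit hM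
    refine dotProduct_eq _ _ fun w => ?_
    simpa [Omega, dotProduct_mulVec] using hXS (0, w)
  have h2 : X.2 = S.2 := by
    apply mulVec_injective_of_isUnit hM
    refine dotProduct_eq _ _ fun y => ?_
    simpa [Omega, h1, dotProduct_comm] using hXS (y, 0)
  exact Prod.ext h1 h2
end
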